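/- In the algebra A of the context, define u_0 = x1 and, for i ≥ 1, u_i = [[u_{i−1}, x2]_L, x1]_L (so u_i = (r_{x1} r_{x2})^i [x1]_L, where r_w[v]_L = [v,w]_L and the brackets are the graded L-brackets of the context). Likewise define w_0 = x2 and w_i = [[w_{i−1}, x1]_L, x2]_L = (r_{x2} r_{x1})^i [x2]_L. Then for all i ≥ 0: u_i = (−2)^{i} · (p12·p21)^{i(i+1)/2} · (x1 x2)^{i} x1 and w_i = (−2)^{i} · (p12·p21)^{i(i+1)/2} · x2 (x1 x2)^{i}. -/

import Mathlib

/-- The relations `x1² = 0`, `x2² = 0` in the free algebra `F⟨x1,x2⟩`. -/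
inductive sqRel (F : Type*) [Field F] :
    FreeAlgebra F (Fin 2) → FreeAlgebra F (Fin 2) → Prop
  | sq1 : sqRel F (FreeAlgebra.ι F 0 * FreeAlgebra.ι F 0) 0
  | sq2 : sqRel F (FreeAlgebra.ι F 1 * FreeAlgebra.ι F 1) 0

/-- The algebra `A = F⟨x1,x2⟩/(x1², x2²)`. -/
abbrev QAlg (F : Type*) [Field F] := RingQuot (sqRel F)

/-- The generator `x1` of `A`. -/
noncomputable def X1 (F : Type*) [Field F] : QAlg F :=
  RingQuot.mkAlgHom F (sqRel F) (FreeAlgebra.ι F 0)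

/-- The generator `x2` of `A`. -/
noncomputable def X2 (F : Type*) [Field F] : QAlg F :=
  RingQuot.mkAlgHom F (sqRel F) (FreeAlgebra.ι F 1)

/-- The bicharacter `p((a,b),(c,d)) = (−1)^{ac}·p12^{ad}·p21^{bc}·(−1)^{bd}` on `ℤ²`. -/
noncomputable def bichar {F : Type*} [Field F] (p12 p21 : F) (d e : ℤ × ℤ) : F :=
  (-1 : F) ^ (d.1 * e.1) * p12 ^ (d.1 * e.2) * p21 ^ (d.2 * e.1) * (-1 : F) ^ (d.2 * e.2)

/-- The graded R-bracket on pairs (degree, element): `[u,v]_R = p_{u,v}·uv − p_{v,u}·vu`. -/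
noncomputable def brR {F : Type*} [Field F] (p12 p21 : F)
    (u v : (ℤ × ℤ) × QAlg F) : (ℤ × ℤ) × QAlg F :=
  (u.1 + v.1, bichar p12 p21 u.1 v.1 • (u.2 * v.2) - bichar p12 p21 v.1 u.1 • (v.2 * u.2))

/-- The graded L-bracket on pairs (degree, element): `[u,v]_L = p_{v,u}·uv − p_{u,v}·vu`. -/
noncomputable def brL {F : Type*} [Field F] (p12 p21 : F)
    (u v : (ℤ × ℤ) × QAlg F) : (ℤ × ℤ) × QAlg F :=
  (u.1 + v.1, bichar p12 p21 v.1 u.1 • (u.2 * v.2) - bichar p12 p21 u.1 v.1 • (v.2 * u.2))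

/-- `x1` together with its degree `(1,0)`. -/
noncomputable def x1P (F : Type*) [Field F] : (ℤ × ℤ) × QAlg F := ((1, 0), X1 F)

/-- `x2` together with its degree `(0,1)`. -/
noncomputable def x2P (F : Type*) [Field F] : (ℤ × ℤ) × QAlg F := ((0, 1), X2 F)

/-- `u_i = (r_{x1} r_{x2})^i [x1]_L`: `u_0 = x1`, `u_{i+1} = [[u_i, x2]_L, x1]_L`
(computed together with its degree). -/
noncomputable def uSeqL {F : Type*} [Field F] (p12 p21 : F) : ℕ → (ℤ × ℤ) × QAlg F
  | 0 => x1P F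
  | i + 1 => brL p12 p21 (brL p12 p21 (uSeqL p12 p21 i) (x2P F)) (x1P F)

/-- `w_i = (r_{x2} r_{x1})^i [x2]_L`: `w_0 = x2`, `w_{i+1} = [[w_i, x1]_L, x2]_L`
(computed together with its degree). -/
noncomputable def wSeqL {F : Type*} [Field F] (p12 p21 : F) : ℕ → (ℤ × ℤ) × QAlg F
  | 0 => x2P F
  | i + 1 => brL p12 p21 (brL p12 p21 (wSeqL p12 p21 i) (x1P F)) (x2P F)

theorem aux_X1sq (F : Type*) [Field F] : X1 F * X1 F = 0 := by
  have h := RingQuot.mkAlgHom_rel F (sqRel.sq1 (F := F))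
  rwa [map_mul, map_zero] at h

theorem aux_X2sq (F : Type*) [Field F] : X2 F * X2 F = 0 := by
  have h := RingQuot.mkAlgHom_rel F (sqRel.sq2 (F := F))
  rwa [map_mul, map_zero] at h

theorem aux_tri (i : ℕ) : (i + 1) * (i + 1 + 1) / 2 = i * (i + 1) / 2 + (i + 1) := by
  rw [show (i + 1) * (i + 1 + 1) = i * (i + 1) + (i + 1) * 2 by ring]
  exact Nat.add_mul_div_right _ _ (by norm_num)

/-- Double bracket with abstract coefficients. -/
theorem aux_step {F A : Type*} [Field F] [Ring A] [Algebra F A] (x y u z : A) (a b c d k e : F)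
    (hux : u * x = 0) (hxu : x * u = 0) (h1 : u * y * x = z) (h2 : x * y * u = z)
    (hc : c * a + d * b = e) :
    c • ((a • ((k • u) * y) - b • (y * (k • u))) * x)
      - d • (x * (a • ((k • u) * y) - b • (y * (k • u)))) = (k * e) • z := by
  have e1 : y * u * x = 0 := by rw [mul_assoc, hux, mul_zero]
  have e2 : x * (u * y) = 0 := by rw [← mul_assoc, hxu, zero_mul]
  have e3 : x * (y * u) = z := by rw [← mul_assoc, h2]
  simp only [sub_mul, mul_sub, smul_mul_assoc, mul_smul_comm, e1, e2, e3, h1, smul_zero, ← hc]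
  module

theorem aux_comm {A : Type*} [Ring A] (x y : A) (i : ℕ) : (x * y) ^ i * x = x * (y * x) ^ i := by
  induction i with
  | zero => simp
  | succ n ih => rw [pow_succ', mul_assoc, ih, pow_succ']; simp only [mul_assoc]

theorem aux_bi {F : Type*} [Field F] (p q : F) (i : ℕ) (s : F) (hs : s * s = 1) :
    (-s * p ^ (i+1)) * (s * q ^ (i+1)) + (-s * q ^ (i+1)) * (s * p ^ (i+1))
      = -2 * (p * q) ^ (i+1) := by
  rw [mul_pow]
  linear_combination (-2 * p ^ (i+1) * q ^ (i+1)) * hs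

theorem aux_sgn {F : Type*} [Field F] (i : ℕ) : (-1 : F) ^ i * (-1) ^ i = 1 := by
  rw [← mul_pow]; simp

theorem aux_z {F : Type*} [Field F] (p : F) (i : ℕ) : p ^ ((i : ℤ) + 1) = p ^ (i + 1) := by
  exact_mod_cast zpow_natCast p (i + 1)

theorem aux_u {F : Type*} [Field F] (p12 p21 : F) (i : ℕ) :
    uSeqL p12 p21 i = (((i : ℤ) + 1, (i : ℤ)),
      ((-2 : F) ^ i * (p12 * p21) ^ (i * (i + 1) / 2)) • ((X1 F * X2 F) ^ i * X1 F)) := by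
  induction i with
  | zero => simp [uSeqL, x1P]
  | succ i ih =>
    rw [uSeqL, ih, aux_tri]
    refine Prod.ext (by simp [brL, x1P, x2P]) ?_
    simp only [brL, x1P, x2P]
    rw [aux_step (X1 F) (X2 F) _ ((X1 F * X2 F) ^ (i+1) * X1 F) _ _ _ _ _
      (-2 * (p12 * p21) ^ (i+1))]
    · congr 1; ring
    · rw [mul_assoc, aux_X1sq, mul_zero]
    · rw [aux_comm, ← mul_assoc, aux_X1sq, zero_mul]
    · rw [pow_succ]; simp only [mul_assoc]
    · rw [pow_succ']; simp only [mul_assoc]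
    · rw [← aux_bi p12 p21 i _ (aux_sgn i)]
      simp [bichar, aux_z, pow_succ]
      ring

theorem aux_w {F : Type*} [Field F] (p12 p21 : F) (i : ℕ) :
    wSeqL p12 p21 i = (((i : ℤ), (i : ℤ) + 1),
      ((-2 : F) ^ i * (p12 * p21) ^ (i * (i + 1) / 2)) • (X2 F * (X1 F * X2 F) ^ i)) := by
  induction i with
  | zero => simp [wSeqL, x2P]
  | succ i ih =>
    rw [wSeqL, ih, aux_tri]
    refine Prod.ext (by simp [brL, x1P, x2P]) ?_
    simp only [brL, x1P, x2P]
    rw [aux_step (X2 F) (X1 F) _ (X2 F * (X1 F * X2 F) ^ (i+1)) _ _ _ _ _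
      (-2 * (p12 * p21) ^ (i+1))]
    · congr 1; ring
    · rw [← aux_comm, mul_assoc, aux_X2sq, mul_zero]
    · rw [← mul_assoc, aux_X2sq, zero_mul]
    · rw [pow_succ]; simp only [mul_assoc]
    · rw [pow_succ']; simp only [mul_assoc]
    · rw [mul_comm p12 p21, ← aux_bi p21 p12 i _ (aux_sgn i)]
      simp [bichar, aux_z, pow_succ]
      ring

theorem stmt14 {F : Type*} [Field F] [CharZero F] (p12 p21 : F)
    (h12 : p12 ≠ 0) (h21 : p21 ≠ 0) (i : ℕ) :
    (uSeqL p12 p21 i).2 =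
      ((-2 : F) ^ i * (p12 * p21) ^ (i * (i + 1) / 2)) • ((X1 F * X2 F) ^ i * X1 F) ∧
    (wSeqL p12 p21 i).2 =
      ((-2 : F) ^ i * (p12 * p21) ^ (i * (i + 1) / 2)) • (X2 F * (X1 F * X2 F) ^ i) := by
  exact ⟨by rw [aux_u], by rw [aux_w]⟩
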